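/- arXiv:2410.06797 — 2 statements merged into one kernel-verified Lean document; each statement's English description precedes it below -/
import Mathlib

section
/- Let (P,φ) be a P-NE pair. If B^{--} ≠ ∅, or if β̄_d^P(φ) > β̄_u^P(φ), then (P,φ) is not stable at cost β for any β ≥ 0. -/
open Finset

namespace CG

variable {N M : ℕ}

/-- Number of players choosing link `a` under profile `φ`. -/
def gamma (φ : Fin N → Fin M) (a : Fin M) : ℕ :=
  (Finset.univ.filter fun i => φ i = a).card

/-- Utility of coalition `C` under profile `φ` at per-communication cost `β`. -/
noncomputable def util (μ : Fin M → ℕ → ℝ) (β : ℝ) (C : Finset (Fin N))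
    (φ : Fin N → Fin M) : ℝ :=
  (∑ i ∈ C, μ (φ i) (gamma φ (φ i))) - ((C.card : ℝ) - 1) * β

/-- `P` is a partition of the player set into (nonempty, pairwise disjoint) coalitions. -/
def IsPartition (P : Finset (Finset (Fin N))) : Prop :=
  (∀ C ∈ P, C.Nonempty) ∧
  (∀ C ∈ P, ∀ C' ∈ P, C ≠ C' → Disjoint C C') ∧
  (∀ i : Fin N, ∃ C ∈ P, i ∈ C)

/-- `φ` is a Nash equilibrium for partition `P`: no coalition of `P` can strictly
improve its utility by unilaterally changing the strategies of its own members. -/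
def IsNE (μ : Fin M → ℕ → ℝ) (β : ℝ) (P : Finset (Finset (Fin N)))
    (φ : Fin N → Fin M) : Prop :=
  ∀ C ∈ P, ∀ φ' : Fin N → Fin M, (∀ i ∉ C, φ' i = φ i) →
    util μ β C φ' ≤ util μ β C φ

/-- Pessimal anticipated worth of a coalition `C`. -/
noncomputable def pess (μ : Fin M → ℕ → ℝ) (β : ℝ) (C : Finset (Fin N)) : ℝ :=
  sInf {x : ℝ | ∃ P' : Finset (Finset (Fin N)), ∃ φ' : Fin N → Fin M,
    IsPartition P' ∧ C ∈ P' ∧ IsNE μ β P' φ' ∧ x = util μ β C φ'}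

/-- `ψ` is a payoff vector consistent with `(P, φ)`. -/
def Consistent (μ : Fin M → ℕ → ℝ) (β : ℝ) (P : Finset (Finset (Fin N)))
    (φ : Fin N → Fin M) (ψ : Fin N → ℝ) : Prop :=
  (∀ j, 0 ≤ ψ j) ∧ ∀ C ∈ P, ∑ j ∈ C, ψ j = util μ β C φ

/-- Coalition `C ∉ P` blocks the configuration with payoff vector `ψ`. -/
def Blocks (μ : Fin M → ℕ → ℝ) (β : ℝ) (P : Finset (Finset (Fin N)))
    (ψ : Fin N → ℝ) (C : Finset (Fin N)) : Prop :=
  C.Nonempty ∧ C ∉ P ∧ ∑ j ∈ C, ψ j < pess μ β C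

/-- The configuration `(P, φ, ψ)` is stable. -/
def ConfigStable (μ : Fin M → ℕ → ℝ) (β : ℝ) (P : Finset (Finset (Fin N)))
    (φ : Fin N → Fin M) (ψ : Fin N → ℝ) : Prop :=
  IsPartition P ∧ IsNE μ β P φ ∧ Consistent μ β P φ ψ ∧
    ∀ C : Finset (Fin N), ¬ Blocks μ β P ψ C

/-- The P-NE pair `(P, φ)` is stable. -/
def PairStable (μ : Fin M → ℕ → ℝ) (β : ℝ) (P : Finset (Finset (Fin N)))
    (φ : Fin N → Fin M) : Prop :=
  ∃ ψ : Fin N → ℝ, ConfigStable μ β P φ ψ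

/-- The partition `P` is stable. -/
def PartStable (μ : Fin M → ℕ → ℝ) (β : ℝ) (P : Finset (Finset (Fin N))) : Prop :=
  ∃ φ : Fin N → Fin M, PairStable μ β P φ

/-- The ALC partition, in which every player is a singleton coalition. -/
def ALC (N : ℕ) : Finset (Finset (Fin N)) :=
  Finset.univ.image fun i => ({i} : Finset (Fin N))

/-- `D_C^P = Σ_i q_i(C)/l_i − 1`. -/
noncomputable def Dcoef (P : Finset (Finset (Fin N))) (C : Finset (Fin N)) : ℝ :=
  (∑ Ci ∈ P, ((Ci ∩ C).card : ℝ) / (Ci.card : ℝ)) - 1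

/-- `Γ_C^P(φ) = Σ_i (q_i(C)/l_i) ν_{C_i}^{0,P}(φ) − ν̲_C^0`. -/
noncomputable def Gam (μ : Fin M → ℕ → ℝ) (P : Finset (Finset (Fin N)))
    (φ : Fin N → Fin M) (C : Finset (Fin N)) : ℝ :=
  (∑ Ci ∈ P, ((Ci ∩ C).card : ℝ) / (Ci.card : ℝ) * util μ 0 Ci φ) - pess μ 0 C

/-- `B^{--}`. -/
def Bmm (μ : Fin M → ℕ → ℝ) (P : Finset (Finset (Fin N))) (φ : Fin N → Fin M) :
    Set (Finset (Fin N)) :=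
  {C | (C.Nonempty ∧ C ∉ P) ∧ Dcoef P C ≤ 0 ∧ Gam μ P φ C < 0}

/-- `B^{+-}`. -/
def Bpm (μ : Fin M → ℕ → ℝ) (P : Finset (Finset (Fin N))) (φ : Fin N → Fin M) :
    Set (Finset (Fin N)) :=
  {C | (C.Nonempty ∧ C ∉ P) ∧ 0 < Dcoef P C ∧ Gam μ P φ C < 0}

/-- `B^{-+}`. -/
def Bmp (μ : Fin M → ℕ → ℝ) (P : Finset (Finset (Fin N))) (φ : Fin N → Fin M) :
    Set (Finset (Fin N)) :=
  {C | (C.Nonempty ∧ C ∉ P) ∧ Dcoef P C < 0 ∧ 0 ≤ Gam μ P φ C}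

/-- `β̄_u^P(φ) = min_{C ∈ B^{-+}} (−Γ_C^P(φ)/D_C^P)`, with `min ∅ = +∞` (in `EReal`). -/
noncomputable def betaU (μ : Fin M → ℕ → ℝ) (P : Finset (Finset (Fin N)))
    (φ : Fin N → Fin M) : EReal :=
  sInf ((fun C => ((-(Gam μ P φ C) / Dcoef P C : ℝ) : EReal)) '' Bmp μ P φ)

/-- `β̄_d^P(φ) = max_{C ∈ B^{+-}} (−Γ_C^P(φ)/D_C^P)`, with `max ∅ = 0` (in `EReal`). -/
noncomputable def betaD (μ : Fin M → ℕ → ℝ) (P : Finset (Finset (Fin N)))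
    (φ : Fin N → Fin M) : EReal :=
  sSup (insert (0 : EReal)
    ((fun C => ((-(Gam μ P φ C) / Dcoef P C : ℝ) : EReal)) '' Bpm μ P φ))

end CG

namespace CG

variable {N M : ℕ}

/-- The cost `β` only shifts the utility of a coalition by a constant. -/
theorem util_eq_util_zero_sub (μ : Fin M → ℕ → ℝ) (β : ℝ) (C : Finset (Fin N))
    (φ : Fin N → Fin M) : util μ β C φ = util μ 0 C φ - ((C.card : ℝ) - 1) * β := by
  simp [util]

/-- Nash equilibria do not depend on the communication cost. -/
theorem isNE_iff_zero (μ : Fin M → ℕ → ℝ) (β : ℝ) (P : Finset (Finset (Fin N)))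
    (φ : Fin N → Fin M) : IsNE μ β P φ ↔ IsNE μ 0 P φ := by
  simp only [IsNE, util_eq_util_zero_sub μ β, sub_le_sub_iff_right]

/-- The set of worths of `C` whose infimum is the pessimal anticipated worth. -/
def worths (μ : Fin M → ℕ → ℝ) (β : ℝ) (C : Finset (Fin N)) : Set ℝ :=
  {x : ℝ | ∃ P' : Finset (Finset (Fin N)), ∃ φ' : Fin N → Fin M,
    IsPartition P' ∧ C ∈ P' ∧ IsNE μ β P' φ' ∧ x = util μ β C φ'}

theorem pess_eq_sInf_worths (μ : Fin M → ℕ → ℝ) (β : ℝ) (C : Finset (Fin N)) :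
    pess μ β C = sInf (worths μ β C) := rfl

theorem bddBelow_worths (μ : Fin M → ℕ → ℝ) (β : ℝ) (C : Finset (Fin N)) :
    BddBelow (worths μ β C) := by
  refine ((Set.finite_range fun φ : Fin N → Fin M => util μ β C φ).subset ?_).bddBelow
  rintro x ⟨P', φ', -, -, -, rfl⟩
  exact ⟨φ', rfl⟩

/-- For nonnegative cost the pessimal worth drops by at most the communication cost. Equality may
fail when no partition containing `C` admits a Nash equilibrium, as both infima are then `0`. -/
theorem pess_zero_sub_le_pess (μ : Fin M → ℕ → ℝ) {β : ℝ} (hβ : 0 ≤ β) {C : Finset (Fin N)}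
    (hC : C.Nonempty) : pess μ 0 C - ((C.card : ℝ) - 1) * β ≤ pess μ β C := by
  have hcard : (1 : ℝ) ≤ C.card := by exact_mod_cast hC.card_pos
  have mem_zero : ∀ x ∈ worths μ β C, x + ((C.card : ℝ) - 1) * β ∈ worths μ 0 C := by
    rintro x ⟨P', φ', hP', hCP', hNE, rfl⟩
    refine ⟨P', φ', hP', hCP', (isNE_iff_zero μ β P' φ').1 hNE, ?_⟩
    rw [util_eq_util_zero_sub μ β]
    ring
  rw [pess_eq_sInf_worths, pess_eq_sInf_worths]
  rcases (worths μ β C).eq_empty_or_nonempty with he | hne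
  · have he0 : worths μ 0 C = ∅ := by
      refine Set.eq_empty_iff_forall_notMem.2 ?_
      rintro x ⟨P', φ', hP', hCP', hNE, -⟩
      exact (Set.eq_empty_iff_forall_notMem.1 he) _
        ⟨P', φ', hP', hCP', (isNE_iff_zero μ β P' φ').2 hNE, rfl⟩
    rw [he, he0, Real.sInf_empty, zero_sub, neg_nonpos]
    exact mul_nonneg (by linarith) hβ
  · refine le_csInf hne fun x hx => ?_
    have := csInf_le (bddBelow_worths μ 0 C) (mem_zero x hx)
    linarith

theorem gamma_comp_perm (σ : Equiv.Perm (Fin N)) (φ : Fin N → Fin M) (a : Fin M) :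
    gamma (φ ∘ σ) a = gamma φ a := by
  unfold gamma
  refine Finset.card_equiv σ fun i => ?_
  simp

theorem util_map_perm (μ : Fin M → ℕ → ℝ) (β : ℝ) (σ : Equiv.Perm (Fin N))
    (C : Finset (Fin N)) (φ : Fin N → Fin M) :
    util μ β (C.map σ.toEmbedding) φ = util μ β C (φ ∘ σ) := by
  simp [util, gamma_comp_perm]

theorem IsPartition.image_map_perm {P : Finset (Finset (Fin N))} (hP : IsPartition P)
    (σ : Equiv.Perm (Fin N)) : IsPartition (P.image (Finset.map σ.toEmbedding)) := by
  obtain ⟨hne, hdisj, hcov⟩ := hP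
  refine ⟨?_, ?_, fun i => ?_⟩
  · simpa using hne
  · simp only [Finset.mem_image]
    rintro _ ⟨A, hA, rfl⟩ _ ⟨B, hB, rfl⟩ hAB
    exact (Finset.disjoint_map _).2 (hdisj A hA B hB fun h => hAB (by rw [h]))
  · obtain ⟨C, hC, hi⟩ := hcov (σ.symm i)
    exact ⟨_, Finset.mem_image_of_mem _ hC, by simpa [Finset.mem_map_equiv] using hi⟩

theorem IsNE.image_map_perm {μ : Fin M → ℕ → ℝ} {β : ℝ} {P : Finset (Finset (Fin N))}
    {φ : Fin N → Fin M} (hφ : IsNE μ β P φ) (σ : Equiv.Perm (Fin N)) :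
    IsNE μ β (P.image (Finset.map σ.toEmbedding)) (φ ∘ σ.symm) := by
  simp only [IsNE, Finset.mem_image]
  rintro _ ⟨C, hC, rfl⟩ φ' hφ'
  have hcancel : (φ ∘ σ.symm) ∘ σ = φ := by
    ext i
    simp
  rw [util_map_perm, util_map_perm, hcancel]
  refine hφ C hC _ fun i hi => ?_
  have := hφ' (σ i) (by simpa using hi)
  simpa using this

theorem worths_subset_worths_map (μ : Fin M → ℕ → ℝ) (β : ℝ) (σ : Equiv.Perm (Fin N))
    (C : Finset (Fin N)) : worths μ β C ⊆ worths μ β (C.map σ.toEmbedding) := by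
  rintro x ⟨P', φ', hP', hC, hNE, rfl⟩
  refine ⟨_, _, hP'.image_map_perm σ, Finset.mem_image_of_mem _ hC, hNE.image_map_perm σ, ?_⟩
  rw [util_map_perm]
  congr 1
  ext i
  simp

/-- The pessimal worth of a coalition is invariant under relabelling the players. -/
theorem pess_map_perm (μ : Fin M → ℕ → ℝ) (β : ℝ) (σ : Equiv.Perm (Fin N))
    (C : Finset (Fin N)) : pess μ β (C.map σ.toEmbedding) = pess μ β C := by
  have hback : (C.map σ.toEmbedding).map σ.symm.toEmbedding = C := by
    ext i
    simp [Finset.mem_map_equiv]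
  rw [pess_eq_sInf_worths, pess_eq_sInf_worths]
  congr 1
  refine Set.Subset.antisymm ?_ (worths_subset_worths_map μ β σ C)
  simpa only [hback] using worths_subset_worths_map μ β σ.symm (C.map σ.toEmbedding)

/-- The permutations of the players that preserve every block of `P`. -/
def blockPerms (P : Finset (Finset (Fin N))) : Finset (Equiv.Perm (Fin N)) :=
  Finset.univ.filter fun σ => ∀ B ∈ P, ∀ k, σ k ∈ B ↔ k ∈ B

theorem mem_blockPerms {P : Finset (Finset (Fin N))} {σ : Equiv.Perm (Fin N)} :
    σ ∈ blockPerms P ↔ ∀ B ∈ P, ∀ k, σ k ∈ B ↔ k ∈ B := by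
  simp [blockPerms]

theorem one_mem_blockPerms (P : Finset (Finset (Fin N))) : 1 ∈ blockPerms P := by
  simp [mem_blockPerms]

theorem IsPartition.mem_iff_mem {P : Finset (Finset (Fin N))} (hP : IsPartition P)
    {A B : Finset (Fin N)} (hA : A ∈ P) (hB : B ∈ P) {j k : Fin N} (hj : j ∈ B) (hk : k ∈ B) :
    j ∈ A ↔ k ∈ A := by
  by_cases hAB : A = B
  · subst hAB
    exact iff_of_true hj hk
  · have hd := hP.2.1 A hA B hB hAB
    exact iff_of_false (fun h => Finset.disjoint_left.1 hd h hj)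
      (fun h => Finset.disjoint_left.1 hd h hk)

theorem IsPartition.swap_mem_blockPerms {P : Finset (Finset (Fin N))} (hP : IsPartition P)
    {B : Finset (Fin N)} (hB : B ∈ P) {j k : Fin N} (hj : j ∈ B) (hk : k ∈ B) :
    Equiv.swap j k ∈ blockPerms P := by
  refine mem_blockPerms.2 fun A hA i => ?_
  have hjk := hP.mem_iff_mem hA hB hj hk
  by_cases hij : i = j
  · rw [hij, Equiv.swap_apply_left, hjk]
  · by_cases hik : i = k
    · rw [hik, Equiv.swap_apply_right, hjk]
    · rw [Equiv.swap_apply_of_ne_of_ne hij hik]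

theorem mul_mem_blockPerms {P : Finset (Finset (Fin N))} {σ τ : Equiv.Perm (Fin N)}
    (hσ : σ ∈ blockPerms P) (hτ : τ ∈ blockPerms P) : σ * τ ∈ blockPerms P := by
  rw [mem_blockPerms] at *
  intro B hB k
  rw [Equiv.Perm.mul_apply, hσ B hB, hτ B hB]

/-- Averaging a payoff vector over the block-preserving permutations gives equal shares. -/
theorem IsPartition.card_mul_sum_blockPerms {P : Finset (Finset (Fin N))} (hP : IsPartition P)
    {B : Finset (Fin N)} (hB : B ∈ P) {j : Fin N} (hj : j ∈ B) (ψ : Fin N → ℝ) :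
    (B.card : ℝ) * ∑ σ ∈ blockPerms P, ψ (σ j) =
      ((blockPerms P).card : ℝ) * ∑ k ∈ B, ψ k := by
  have hconst : ∀ k ∈ B, ∑ σ ∈ blockPerms P, ψ (σ k) = ∑ σ ∈ blockPerms P, ψ (σ j) := by
    intro k hk
    have hs := hP.swap_mem_blockPerms hB hj hk
    refine Finset.sum_bij' (fun σ _ => σ * Equiv.swap j k) (fun σ _ => σ * Equiv.swap j k)
      (fun σ hσ => mul_mem_blockPerms hσ hs) (fun σ hσ => mul_mem_blockPerms hσ hs)
      ?_ ?_ ?_ <;> simp [mul_assoc]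
  have hblock : ∀ σ ∈ blockPerms P, ∑ k ∈ B, ψ (σ k) = ∑ k ∈ B, ψ k := fun σ hσ =>
    Finset.sum_equiv σ (fun k => (mem_blockPerms.1 hσ B hB k).symm) fun _ _ => rfl
  calc (B.card : ℝ) * ∑ σ ∈ blockPerms P, ψ (σ j)
      = ∑ k ∈ B, ∑ σ ∈ blockPerms P, ψ (σ k) := by
        rw [Finset.sum_congr rfl hconst, Finset.sum_const, nsmul_eq_mul]
    _ = ∑ σ ∈ blockPerms P, ∑ k ∈ B, ψ (σ k) := Finset.sum_comm
    _ = ((blockPerms P).card : ℝ) * ∑ k ∈ B, ψ k := by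
        rw [Finset.sum_congr rfl hblock, Finset.sum_const, nsmul_eq_mul]

theorem IsPartition.sum_inter {P : Finset (Finset (Fin N))} (hP : IsPartition P)
    (C : Finset (Fin N)) (f : Fin N → ℝ) :
    ∑ j ∈ C, f j = ∑ B ∈ P, ∑ j ∈ B ∩ C, f j := by
  rw [← Finset.sum_biUnion]
  · refine Finset.sum_congr ?_ fun _ _ => rfl
    ext j
    obtain ⟨B, hB, hj⟩ := hP.2.2 j
    simp only [Finset.mem_biUnion, Finset.mem_inter]
    exact ⟨fun hC => ⟨B, hB, hj, hC⟩, fun ⟨_, _, _, hC⟩ => hC⟩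
  · intro A hA B hB hAB
    exact (hP.2.1 A hA B hB hAB).mono Finset.inter_subset_left Finset.inter_subset_left

theorem map_notMem_of_mem_blockPerms {P : Finset (Finset (Fin N))} {σ : Equiv.Perm (Fin N)}
    (hσ : σ ∈ blockPerms P) {C : Finset (Fin N)} (hC : C ∉ P) : C.map σ.toEmbedding ∉ P := by
  intro h
  have hmap : C = C.map σ.toEmbedding := by
    ext k
    rw [← mem_blockPerms.1 hσ _ h k]
    simp
  exact hC (hmap ▸ h)

/-- The equal-share payoff of an outside coalition is at least its pessimal worth in any stable
configuration. -/
theorem ConfigStable.pess_le_sum {μ : Fin M → ℕ → ℝ} {β : ℝ} {P : Finset (Finset (Fin N))}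
    {φ : Fin N → Fin M} {ψ : Fin N → ℝ} (h : ConfigStable μ β P φ ψ) {C : Finset (Fin N)}
    (hne : C.Nonempty) (hC : C ∉ P) :
    pess μ β C ≤ ∑ B ∈ P, ((B ∩ C).card : ℝ) / (B.card : ℝ) * util μ β B φ := by
  obtain ⟨hP, -, ⟨-, hcons⟩, hblock⟩ := h
  have hcard : (0 : ℝ) < (blockPerms P).card := by
    exact_mod_cast Finset.card_pos.2 ⟨1, one_mem_blockPerms P⟩
  have hσ : ∀ σ ∈ blockPerms P, pess μ β C ≤ ∑ j ∈ C, ψ (σ j) := by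
    intro σ hσ
    have hnb := hblock (C.map σ.toEmbedding)
    simp only [Blocks, pess_map_perm, Finset.sum_map, not_and, not_lt] at hnb
    exact hnb (hne.map) (map_notMem_of_mem_blockPerms hσ hC)
  have hsum : ∑ σ ∈ blockPerms P, ∑ j ∈ C, ψ (σ j) = ((blockPerms P).card : ℝ) *
      ∑ B ∈ P, ((B ∩ C).card : ℝ) / (B.card : ℝ) * util μ β B φ := by
    rw [Finset.sum_comm, hP.sum_inter C, Finset.mul_sum]
    refine Finset.sum_congr rfl fun B hB => ?_
    have hBpos : (B.card : ℝ) ≠ 0 := by exact_mod_cast (hP.1 B hB).card_pos.ne'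
    have hshare : ∀ j ∈ B ∩ C, ∑ σ ∈ blockPerms P, ψ (σ j) =
        ((blockPerms P).card : ℝ) * util μ β B φ / B.card := by
      intro j hj
      rw [eq_div_iff hBpos, mul_comm, ← hcons B hB]
      exact hP.card_mul_sum_blockPerms hB (Finset.mem_inter.1 hj).1 ψ
    rw [Finset.sum_congr rfl hshare, Finset.sum_const, nsmul_eq_mul]
    ring
  have hle := Finset.card_nsmul_le_sum _ _ _ hσ
  rw [nsmul_eq_mul, hsum] at hle
  exact le_of_mul_le_mul_left hle hcard

/-- The equal-share payoff of `C`, split into its cost-free part and its communication cost. -/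
theorem IsPartition.sum_share_util {P : Finset (Finset (Fin N))} (hP : IsPartition P)
    (μ : Fin M → ℕ → ℝ) (β : ℝ) (φ : Fin N → Fin M) (C : Finset (Fin N)) :
    ∑ B ∈ P, ((B ∩ C).card : ℝ) / (B.card : ℝ) * util μ β B φ =
      Gam μ P φ C + β * Dcoef P C + (pess μ 0 C - ((C.card : ℝ) - 1) * β) := by
  have hcard : (C.card : ℝ) = ∑ B ∈ P, ((B ∩ C).card : ℝ) := by
    simpa using hP.sum_inter C fun _ => 1
  have hterm : ∀ B ∈ P, ((B ∩ C).card : ℝ) / (B.card : ℝ) * util μ β B φ =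
      ((B ∩ C).card : ℝ) / (B.card : ℝ) * util μ 0 B φ - ((B ∩ C).card : ℝ) * β +
        ((B ∩ C).card : ℝ) / (B.card : ℝ) * β := by
    intro B hB
    have hBpos : (B.card : ℝ) ≠ 0 := by exact_mod_cast (hP.1 B hB).card_pos.ne'
    rw [util_eq_util_zero_sub μ β]
    field_simp
    ring
  rw [Finset.sum_congr rfl hterm, Finset.sum_add_distrib, Finset.sum_sub_distrib,
    ← Finset.sum_mul, ← Finset.sum_mul, ← hcard, Gam, Dcoef]
  ring

/-- Stability forces `Γ_C + β D_C ≥ 0` for every coalition outside the partition. -/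
theorem PairStable.gam_add_nonneg {μ : Fin M → ℕ → ℝ} {β : ℝ} (hβ : 0 ≤ β)
    {P : Finset (Finset (Fin N))} {φ : Fin N → Fin M} (h : PairStable μ β P φ)
    {C : Finset (Fin N)} (hC : C.Nonempty ∧ C ∉ P) :
    0 ≤ Gam μ P φ C + β * Dcoef P C := by
  obtain ⟨ψ, hψ⟩ := h
  have h₁ := hψ.pess_le_sum hC.1 hC.2
  rw [hψ.1.sum_share_util] at h₁
  have h₂ := pess_zero_sub_le_pess μ hβ hC.1
  linarith

end CG

open CG in
/-- if `B^{--} ≠ ∅`, or `β̄_d^P(φ) > β̄_u^P(φ)`, then the P-NE pair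
`(P, φ)` is not stable at any cost `β ≥ 0`. -/
theorem stmt5 {N M : ℕ} (hN : 2 ≤ N) (hMN : N ≤ M)
    (μ : Fin M → ℕ → ℝ)
    (hpos : ∀ a : Fin M, ∀ k : ℕ, 1 ≤ k → k ≤ N → 0 < μ a k)
    (hmono : ∀ a b : Fin M, a ≤ b → μ b 1 ≤ μ a 1)
    (P : Finset (Finset (Fin N))) (hP : IsPartition P)
    (φ : Fin N → Fin M) (hφ : IsNE μ 0 P φ)
    (h : (Bmm μ P φ).Nonempty ∨ betaU μ P φ < betaD μ P φ) :
    ∀ β : ℝ, 0 ≤ β → ¬ PairStable μ β P φ := by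
  intro β hβ hst
  rcases h with ⟨C, hC, hD, hG⟩ | hlt
  · have h₁ := hst.gam_add_nonneg hβ hC
    have h₂ := mul_nonpos_of_nonneg_of_nonpos hβ hD
    linarith
  · obtain ⟨_, ⟨C, ⟨hC, hD, hG⟩, rfl⟩, hlt⟩ := sInf_lt_iff.1 hlt
    obtain ⟨b, hb, hlt⟩ := lt_sSup_iff.1 hlt
    have hup : β ≤ -(Gam μ P φ C) / Dcoef P C := by
      rw [le_div_iff_of_neg hD]
      linarith [hst.gam_add_nonneg hβ hC]
    rcases hb with rfl | ⟨C', ⟨hC', hD', hG'⟩, rfl⟩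
    · have : -(Gam μ P φ C) / Dcoef P C < 0 := EReal.coe_lt_coe_iff.1 hlt
      linarith
    · have hlow : -(Gam μ P φ C') / Dcoef P C' ≤ β := by
        rw [div_le_iff₀ hD']
        linarith [hst.gam_add_nonneg hβ hC']
      have := EReal.coe_lt_coe_iff.1 hlt
      linarith
end

section
/- Assume M ≥ N, equi-divisible congestion, and (when M > N) μ_N > μ_{N+1}. Suppose μ_k/2 > μ_N for some 1 ≤ k ≤ N−1. Then at β = 0, every partition P with |P| > N−k is blocked by the grand coalition G and hence is not stable at β = 0. In particular, for every such P there is no Nash equilibrium of P in which all players use distinct links, so the total worth at any NE of P is strictly less than Σ_{i=1}^N μ_i = ν̲_G. -/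
open Finset

namespace CG

variable {N M : ℕ}

theorem one_le_gamma (φ : Fin N → Fin M) (i : Fin N) : 1 ≤ gamma φ (φ i) :=
  Finset.card_pos.mpr ⟨i, by simp⟩

theorem gamma_of_injective {φ : Fin N → Fin M} (hφ : Function.Injective φ) (i : Fin N) :
    gamma φ (φ i) = 1 := by
  unfold gamma
  rw [Finset.card_eq_one]
  exact ⟨i, by ext j; simp [hφ.eq_iff]⟩

theorem IsPartition.biUnion_eq_univ {P : Finset (Finset (Fin N))} (hP : IsPartition P) :
    P.biUnion id = Finset.univ := by
  ext i
  simpa using hP.2.2 i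

theorem IsPartition.sum_sum {P : Finset (Finset (Fin N))} (hP : IsPartition P)
    {A : Type*} [AddCommMonoid A] (f : Fin N → A) :
    ∑ C ∈ P, ∑ i ∈ C, f i = ∑ i, f i := by
  rw [← hP.biUnion_eq_univ]
  exact (Finset.sum_biUnion (t := id) fun C hC C' hC' h => hP.2.1 C hC C' hC' h).symm

theorem IsPartition.card_add_card_le {P : Finset (Finset (Fin N))} (hP : IsPartition P)
    {C : Finset (Fin N)} (hC : C ∈ P) : P.card + C.card ≤ N + 1 := by
  have h1 : ∑ C' ∈ P, C'.card = N := by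
    simpa using hP.sum_sum fun _ => (1 : ℕ)
  have h2 : (P.erase C).card ≤ ∑ C' ∈ P.erase C, C'.card := by
    simpa using Finset.card_nsmul_le_sum (P.erase C) Finset.card 1 fun C' h =>
      Finset.card_pos.mpr (hP.1 C' (Finset.mem_of_mem_erase h))
  have h3 := Finset.add_sum_erase P Finset.card hC
  have h4 := Finset.card_erase_add_one hC
  omega

theorem sum_util_zero (μ : Fin M → ℕ → ℝ) {P : Finset (Finset (Fin N))} (hP : IsPartition P)
    (φ : Fin N → Fin M) : ∑ C ∈ P, util μ 0 C φ = util μ 0 Finset.univ φ := by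
  simpa [util] using hP.sum_sum fun i => μ (φ i) (gamma φ (φ i))

theorem isPartition_singleton_univ (hN : 0 < N) :
    IsPartition ({Finset.univ} : Finset (Finset (Fin N))) := by
  refine ⟨fun C hC => ?_, fun C hC C' hC' h => ?_, fun i => ⟨Finset.univ, by simp⟩⟩
  · rw [Finset.mem_singleton.mp hC]
    exact ⟨⟨0, hN⟩, Finset.mem_univ _⟩
  · exact absurd ((Finset.mem_singleton.mp hC).trans (Finset.mem_singleton.mp hC').symm) h

theorem IsPartition.card_le_one {P : Finset (Finset (Fin N))} (hP : IsPartition P)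
    (h : Finset.univ ∈ P) : P.card ≤ 1 := by
  have := hP.card_add_card_le h
  rw [Finset.card_univ, Fintype.card_fin] at this
  omega

/-- With equi-divisible congestion, the total utility is the total value of the occupied links. -/
theorem util_univ_eq_sum_image {μ : Fin M → ℕ → ℝ}
    (hequi : ∀ a : Fin M, ∀ k : ℕ, 1 ≤ k → μ a k = μ a 1 / k) (φ : Fin N → Fin M) :
    util μ 0 Finset.univ φ = ∑ a ∈ Finset.univ.image φ, μ a 1 := by
  simp only [util, mul_zero, sub_zero]
  rw [← Finset.sum_fiberwise_of_maps_to (t := Finset.univ.image φ) (g := φ) (by simp)]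
  refine Finset.sum_congr rfl fun a ha => ?_
  obtain ⟨i, -, rfl⟩ := Finset.mem_image.mp ha
  have hpos := one_le_gamma φ i
  have hsum : ∑ j ∈ Finset.univ.filter (fun j => φ j = φ i), μ (φ j) (gamma φ (φ j)) =
      ∑ j ∈ Finset.univ.filter (fun j => φ j = φ i), μ (φ i) (gamma φ (φ i)) :=
    Finset.sum_congr rfl fun j hj => by rw [(Finset.mem_filter.mp hj).2]
  rw [hsum, Finset.sum_const, nsmul_eq_mul, hequi _ _ hpos]
  change (gamma φ (φ i) : ℝ) * _ = _
  have : (gamma φ (φ i) : ℝ) ≠ 0 := by positivity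
  field_simp

/-- Moving from `S` to `T` with `S.card ≤ T.card` increases the sum of `f` by at least `c` per
extra element if `f` is at most `c` off `T` and at least `c` on `T`. -/
theorem sum_add_le_sum_of_threshold {α : Type*} [DecidableEq α] {f : α → ℝ} {c : ℝ}
    {S T : Finset α} (hT : ∀ a ∈ T, c ≤ f a) (hS : ∀ a ∉ T, f a ≤ c) :
    ∑ a ∈ S, f a + ((T.card : ℝ) - S.card) * c ≤ ∑ a ∈ T, f a := by
  have h1 := Finset.sum_le_card_nsmul (S \ T) f c fun a ha => hS a (Finset.mem_sdiff.mp ha).2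
  have h2 := Finset.card_nsmul_le_sum (T \ S) f c fun a ha => hT a (Finset.mem_sdiff.mp ha).1
  have h3 := Finset.sum_inter_add_sum_sdiff S T f
  have h4 := Finset.sum_inter_add_sum_sdiff T S f
  have h5 : ((S ∩ T).card : ℝ) + (S \ T).card = S.card := by
    exact_mod_cast Finset.card_inter_add_card_sdiff S T
  have h6 : ((T ∩ S).card : ℝ) + (T \ S).card = T.card := by
    exact_mod_cast Finset.card_inter_add_card_sdiff T S
  rw [nsmul_eq_mul] at h1 h2
  rw [Finset.inter_comm] at h4 h6
  rw [← h5, ← h6]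
  linarith

/-- The total utility falls short of the value of the `N` best links by at least the value of
the `N`-th link for every link lost to congestion. -/
theorem util_univ_add_le (hN : 0 < N) (hMN : N ≤ M) {μ : Fin M → ℕ → ℝ}
    (hmono : ∀ a b : Fin M, a ≤ b → μ b 1 ≤ μ a 1)
    (hequi : ∀ a : Fin M, ∀ k : ℕ, 1 ≤ k → μ a k = μ a 1 / k) (φ : Fin N → Fin M) :
    util μ 0 Finset.univ φ + ((N : ℝ) - (Finset.univ.image φ).card) *
      μ (Fin.castLE hMN ⟨N - 1, by omega⟩) 1 ≤ ∑ i : Fin N, μ (Fin.castLE hMN i) 1 := by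
  have hinj : Function.Injective (Fin.castLE hMN) := Fin.castLE_injective hMN
  have h := sum_add_le_sum_of_threshold (f := fun a => μ a 1)
    (c := μ (Fin.castLE hMN ⟨N - 1, by omega⟩) 1) (S := Finset.univ.image φ)
    (T := Finset.univ.image (Fin.castLE hMN)) (fun a ha => ?_) (fun a ha => ?_)
  · rw [Finset.card_image_of_injective _ hinj, Finset.card_univ, Fintype.card_fin,
      Finset.sum_image fun i _ j _ hij => hinj hij] at h
    rwa [util_univ_eq_sum_image hequi]
  · obtain ⟨i, -, rfl⟩ := Finset.mem_image.mp ha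
    refine hmono _ _ (Fin.le_def.mpr ?_)
    simp only [Fin.val_castLE]
    omega
  · refine hmono _ _ (Fin.le_def.mpr ?_)
    simp only [Fin.val_castLE]
    by_contra hlt
    exact ha (Finset.mem_image.mpr ⟨⟨a, by omega⟩, Finset.mem_univ _, rfl⟩)

theorem util_univ_le (hN : 0 < N) (hMN : N ≤ M) {μ : Fin M → ℕ → ℝ}
    (hpos : ∀ a : Fin M, 0 < μ a 1)
    (hmono : ∀ a b : Fin M, a ≤ b → μ b 1 ≤ μ a 1)
    (hequi : ∀ a : Fin M, ∀ k : ℕ, 1 ≤ k → μ a k = μ a 1 / k) (φ : Fin N → Fin M) :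
    util μ 0 Finset.univ φ ≤ ∑ i : Fin N, μ (Fin.castLE hMN i) 1 := by
  have h := util_univ_add_le hN hMN hmono hequi φ
  have hcard : ((Finset.univ.image φ).card : ℝ) ≤ N := by
    exact_mod_cast Finset.card_image_le.trans_eq (by simp)
  have := mul_nonneg (sub_nonneg.mpr hcard) (hpos (Fin.castLE hMN ⟨N - 1, by omega⟩)).le
  linarith

theorem util_univ_lt (hN : 0 < N) (hMN : N ≤ M) {μ : Fin M → ℕ → ℝ}
    (hpos : ∀ a : Fin M, 0 < μ a 1)
    (hmono : ∀ a b : Fin M, a ≤ b → μ b 1 ≤ μ a 1)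
    (hequi : ∀ a : Fin M, ∀ k : ℕ, 1 ≤ k → μ a k = μ a 1 / k) {φ : Fin N → Fin M}
    (hφ : ¬ Function.Injective φ) :
    util μ 0 Finset.univ φ < ∑ i : Fin N, μ (Fin.castLE hMN i) 1 := by
  have h := util_univ_add_le hN hMN hmono hequi φ
  have hcard : (Finset.univ.image φ).card < N := by
    refine lt_of_le_of_ne (Finset.card_image_le.trans_eq (by simp)) fun heq => hφ ?_
    have hinj := Finset.card_image_iff.mp (heq.trans (Finset.card_fin N).symm)
    rwa [Finset.coe_univ, Set.injOn_univ] at hinj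
  have hcard' : ((Finset.univ.image φ).card : ℝ) < N := by exact_mod_cast hcard
  have := mul_pos (sub_pos.mpr hcard') (hpos (Fin.castLE hMN ⟨N - 1, by omega⟩))
  linarith

theorem util_univ_castLE (hMN : N ≤ M) (μ : Fin M → ℕ → ℝ) :
    util μ 0 Finset.univ (Fin.castLE hMN) = ∑ i : Fin N, μ (Fin.castLE hMN i) 1 := by
  simp [util, gamma_of_injective (Fin.castLE_injective hMN)]

theorem pess_univ_eq (hN : 0 < N) (hMN : N ≤ M) {μ : Fin M → ℕ → ℝ}
    (hpos : ∀ a : Fin M, 0 < μ a 1)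
    (hmono : ∀ a b : Fin M, a ≤ b → μ b 1 ≤ μ a 1)
    (hequi : ∀ a : Fin M, ∀ k : ℕ, 1 ≤ k → μ a k = μ a 1 / k) :
    pess μ 0 (Finset.univ : Finset (Fin N)) = ∑ i : Fin N, μ (Fin.castLE hMN i) 1 := by
  unfold pess
  refine (congrArg sInf ?_).trans (csInf_singleton (∑ i : Fin N, μ (Fin.castLE hMN i) 1))
  ext x
  rw [Set.mem_singleton_iff]
  constructor
  · rintro ⟨P', φ', -, hmem, hNE, rfl⟩
    refine le_antisymm (util_univ_le hN hMN hpos hmono hequi φ') ?_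
    rw [← util_univ_castLE hMN μ]
    exact hNE _ hmem _ (by simp)
  · rintro rfl
    refine ⟨{Finset.univ}, Fin.castLE hMN, isPartition_singleton_univ hN, by simp, ?_,
      (util_univ_castLE hMN μ).symm⟩
    intro C hC φ' _
    rw [Finset.mem_singleton.mp hC, util_univ_castLE]
    exact util_univ_le hN hMN hpos hmono hequi φ'

/-- If all links are used by at most one player, then a member of a coalition can collect at
least half of the value of a link that his own coalition does not use, and this does not hurt the
other members. -/
theorem IsNE.half_le_of_injective {μ : Fin M → ℕ → ℝ} (hpos : ∀ a : Fin M, 0 < μ a 1)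
    (hequi : ∀ a : Fin M, ∀ k : ℕ, 1 ≤ k → μ a k = μ a 1 / k)
    {P : Finset (Finset (Fin N))} {φ : Fin N → Fin M} (hNE : IsNE μ 0 P φ)
    (hφ : Function.Injective φ) {C : Finset (Fin N)} (hC : C ∈ P) {p : Fin N} (hp : p ∈ C)
    {a : Fin M} (ha : ∀ i ∈ C, φ i ≠ a) : μ a 1 / 2 ≤ μ (φ p) 1 := by
  have h := hNE C hC (Function.update φ p a) fun i hi =>
    Function.update_of_ne (ne_of_mem_of_not_mem hp hi).symm _ _
  simp only [util, mul_zero, sub_zero, gamma_of_injective hφ] at h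
  rw [← Finset.add_sum_erase C _ hp, ← Finset.add_sum_erase C (fun i => μ (φ i) 1) hp] at h
  have hrest : ∑ i ∈ C.erase p, μ (Function.update φ p a i)
      (gamma (Function.update φ p a) (Function.update φ p a i)) =
      ∑ i ∈ C.erase p, μ (φ i) 1 := by
    refine Finset.sum_congr rfl fun i hi => ?_
    obtain ⟨hip, hiC⟩ := Finset.mem_erase.mp hi
    rw [Function.update_of_ne hip]
    congr 1
    unfold gamma
    rw [Finset.card_eq_one]
    refine ⟨i, ?_⟩
    ext j
    by_cases hj : j = p
    · subst hj
      simp [(ha i hiC).symm, Ne.symm hip]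
    · simp [Function.update_of_ne hj, hφ.eq_iff]
  have hone := one_le_gamma (Function.update φ p a) p
  have htwo : gamma (Function.update φ p a) (Function.update φ p a p) ≤ 2 := by
    have hle : (Finset.univ.filter fun i => φ i = a).card ≤ 1 :=
      Finset.card_le_one.mpr fun i hi j hj => hφ
        ((Finset.mem_filter.mp hi).2.trans (Finset.mem_filter.mp hj).2.symm)
    refine (Finset.card_le_card (t := insert p (Finset.univ.filter fun i => φ i = a))
      fun j hj => ?_).trans ((Finset.card_insert_le _ _).trans (by omega))
    by_cases hjp : j = p
    · simp [hjp]
    · simpa [hjp] using hj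
  have hhalf : μ a 1 / 2 ≤ μ (Function.update φ p a p)
      (gamma (Function.update φ p a) (Function.update φ p a p)) := by
    rw [hequi _ _ hone]
    simp only [Function.update_self] at hone htwo ⊢
    refine div_le_div_of_nonneg_left (hpos a).le ?_ ?_
    · exact_mod_cast hone
    · exact_mod_cast htwo
  linarith

/-- At an equilibrium with distinct links, the coalition of a player on a link beyond the first
`N - 1` occupies the `k` best links as well, which leaves room for at most `N - k` coalitions. -/
theorem IsNE.not_injective (hN : 0 < N) (hMN : N ≤ M) {μ : Fin M → ℕ → ℝ}
    (hpos : ∀ a : Fin M, 0 < μ a 1)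
    (hmono : ∀ a b : Fin M, a ≤ b → μ b 1 ≤ μ a 1)
    (hequi : ∀ a : Fin M, ∀ k : ℕ, 1 ≤ k → μ a k = μ a 1 / k)
    {k : ℕ} (hkN : k ≤ N - 1)
    (hbig : μ (Fin.castLE hMN ⟨N - 1, by omega⟩) 1 <
      μ (Fin.castLE hMN ⟨k - 1, by omega⟩) 1 / 2)
    {P : Finset (Finset (Fin N))} (hP : IsPartition P) (hcard : N - k < P.card)
    {φ : Fin N → Fin M} (hNE : IsNE μ 0 P φ) : ¬ Function.Injective φ := by
  intro hφ
  obtain ⟨p, hp⟩ : ∃ p, N - 1 ≤ (φ p : ℕ) := by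
    by_contra! hlt
    have := Fintype.card_le_of_injective (fun i => (⟨φ i, hlt i⟩ : Fin (N - 1)))
      fun i j hij => hφ (Fin.ext (Fin.mk.inj_iff.mp hij))
    simp only [Fintype.card_fin] at this
    omega
  obtain ⟨C, hC, hpC⟩ := hP.2.2 p
  have hkM : k ≤ M := by omega
  have hle : μ (φ p) 1 ≤ μ (Fin.castLE hMN ⟨N - 1, by omega⟩) 1 := hmono _ _ (Fin.le_def.mpr hp)
  have hsub : insert (φ p) (Finset.univ.image (Fin.castLE hkM)) ⊆ C.image φ := by
    refine Finset.insert_subset (Finset.mem_image_of_mem φ hpC) fun a ha => ?_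
    obtain ⟨j, -, rfl⟩ := Finset.mem_image.mp ha
    by_contra hnot
    have hhalf := hNE.half_le_of_injective hpos hequi hφ hC hpC (a := Fin.castLE hkM j)
      fun i hi heq => hnot (Finset.mem_image.mpr ⟨i, hi, heq⟩)
    have hj : μ (Fin.castLE hMN ⟨k - 1, by omega⟩) 1 ≤ μ (Fin.castLE hkM j) 1 := by
      refine hmono _ _ (Fin.le_def.mpr ?_)
      simp only [Fin.val_castLE]
      omega
    linarith
  have hnot : φ p ∉ Finset.univ.image (Fin.castLE hkM) := by
    intro hmem
    obtain ⟨j, -, hj⟩ := Finset.mem_image.mp hmem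
    have := congrArg Fin.val hj
    simp only [Fin.val_castLE] at this
    omega
  have h1 := Finset.card_le_card hsub
  rw [Finset.card_insert_of_notMem hnot,
    Finset.card_image_of_injective _ (Fin.castLE_injective hkM), Finset.card_univ,
    Fintype.card_fin] at h1
  have h2 : (C.image φ).card ≤ C.card := Finset.card_image_le
  have h3 := hP.card_add_card_le hC
  omega

end CG

open CG in
/-- with equi-divisible congestion and `μ_k/2 > μ_N` for some
`1 ≤ k ≤ N−1`, every partition `P` with `|P| > N−k` has no NE with all-distinct
links, its total worth at any NE is `< Σ μ_i = ν̲_G`, and it is blocked by the grand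
coalition at `β = 0`, hence not stable at `β = 0`. -/
theorem stmt16 {N M : ℕ} (hN : 2 ≤ N) (hMN : N ≤ M)
    (μ : Fin M → ℕ → ℝ)
    (hpos : ∀ a : Fin M, ∀ k : ℕ, 1 ≤ k → k ≤ N → 0 < μ a k)
    (hmono : ∀ a b : Fin M, a ≤ b → μ b 1 ≤ μ a 1)
    (hequi : ∀ a : Fin M, ∀ k : ℕ, 1 ≤ k → μ a k = μ a 1 / k)
    (hgap : ∀ h : N < M, μ (⟨N, h⟩ : Fin M) 1 < μ (Fin.castLE hMN ⟨N - 1, by omega⟩) 1)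
    (k : ℕ) (hk1 : 1 ≤ k) (hkN : k ≤ N - 1)
    (hbig : μ (Fin.castLE hMN ⟨N - 1, by omega⟩) 1 <
      μ (Fin.castLE hMN ⟨k - 1, by omega⟩) 1 / 2) :
    pess μ 0 (Finset.univ : Finset (Fin N)) = (∑ i : Fin N, μ (Fin.castLE hMN i) 1) ∧
    ∀ P : Finset (Finset (Fin N)), IsPartition P → N - k < P.card →
      (∀ φ : Fin N → Fin M, IsNE μ 0 P φ → ¬ Function.Injective φ) ∧
      (∀ φ : Fin N → Fin M, IsNE μ 0 P φ →
        ∑ C ∈ P, util μ 0 C φ < ∑ i : Fin N, μ (Fin.castLE hMN i) 1) ∧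
      (∀ φ : Fin N → Fin M, ∀ ψ : Fin N → ℝ, IsNE μ 0 P φ → Consistent μ 0 P φ ψ →
        Blocks μ 0 P ψ (Finset.univ : Finset (Fin N))) ∧
      ¬ PartStable μ 0 P := by
  have hN0 : 0 < N := by omega
  have hpos1 : ∀ a : Fin M, 0 < μ a 1 := fun a => hpos a 1 le_rfl (by omega)
  have hpess := pess_univ_eq hN0 hMN hpos1 hmono hequi
  refine ⟨hpess, fun P hP hcard => ?_⟩
  have hninj (φ : Fin N → Fin M) (hNE : IsNE μ 0 P φ) : ¬ Function.Injective φ :=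
    hNE.not_injective hN0 hMN hpos1 hmono hequi hkN hbig hP hcard
  have hlt (φ : Fin N → Fin M) (hNE : IsNE μ 0 P φ) :
      ∑ C ∈ P, util μ 0 C φ < ∑ i : Fin N, μ (Fin.castLE hMN i) 1 := by
    rw [sum_util_zero μ hP]
    exact util_univ_lt hN0 hMN hpos1 hmono hequi (hninj φ hNE)
  have hblock (φ : Fin N → Fin M) (ψ : Fin N → ℝ) (hNE : IsNE μ 0 P φ)
      (hψ : Consistent μ 0 P φ ψ) : Blocks μ 0 P ψ (Finset.univ : Finset (Fin N)) := by
    refine ⟨⟨⟨0, hN0⟩, Finset.mem_univ _⟩, fun hmem => ?_, ?_⟩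
    · have := hP.card_le_one hmem
      omega
    · rw [hpess, ← hP.sum_sum, Finset.sum_congr rfl hψ.2]
      exact hlt φ hNE
  refine ⟨hninj, hlt, hblock, ?_⟩
  rintro ⟨φ, ψ, -, hNE, hψ, hstable⟩
  exact hstable _ (hblock φ ψ hNE hψ)
end
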